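/- Let F denote the Fourier–Plancherel transform on L²(ℝ) with the convention (Fh)(t) = (2π)^{−1/2} ∫_ℝ e^{−itξ} h(ξ) dξ. Then U maps the Hardy space H² ⊆ L²(S¹) onto F(L²₊), where L²₊ ⊆ L²(ℝ) is the closed subspace of functions vanishing almost everywhere on (−∞,0); that is, U(H²) = F(L²₊). -/

import Mathlib

open MeasureTheory Filter

noncomputable section

/-- Arc-length measure on the unit circle `S¹ = {z ∈ ℂ : |z| = 1}`, realized as the
measure on `ℂ` obtained as the pushforward of Lebesgue measure on `(-π, π]` under
`θ ↦ e^{iθ}`. -/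
def circleMeasure : Measure ℂ :=
  Measure.map (fun θ : ℝ => Complex.exp (θ * Complex.I))
    ((volume : Measure ℝ).restrict (Set.Ioc (-Real.pi) Real.pi))

/-- The Hardy space `H² ⊆ L²(S¹)`: the closed linear span of the monomials
`z ↦ zⁿ`, `n ≥ 0`. -/
def hardySpace : Submodule ℂ (Lp ℂ 2 circleMeasure) :=
  (Submodule.span ℂ
    {f : Lp ℂ 2 circleMeasure |
      ∃ n : ℕ, (⇑f : ℂ → ℂ) =ᵐ[circleMeasure] fun z : ℂ => z ^ n}).topologicalClosure

/-- `U` is the unitary `(Ug)(t) = (√2/(1+it)) · g((1−it)/(1+it))` from `L²(S¹)` to `L²(ℝ)`. -/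
def IsCayleyUnitary (U : Lp ℂ 2 circleMeasure ≃ₗᵢ[ℂ] Lp ℂ 2 (volume : Measure ℝ)) : Prop :=
  ∀ g : Lp ℂ 2 circleMeasure,
    (⇑(U g) : ℝ → ℂ) =ᵐ[volume]
      fun t : ℝ => ((Real.sqrt 2 : ℂ) / (1 + (t : ℂ) * Complex.I)) *
        g ((1 - (t : ℂ) * Complex.I) / (1 + (t : ℂ) * Complex.I))

/-- `F` is the Fourier–Plancherel transform with convention
`(Fh)(t) = (2π)^{-1/2} ∫ e^{-itξ} h(ξ) dξ`. -/
def FourierConvention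
    (F : Lp ℂ 2 (volume : Measure ℝ) ≃ₗᵢ[ℂ] Lp ℂ 2 (volume : Measure ℝ)) : Prop :=
  ∀ h : Lp ℂ 2 (volume : Measure ℝ), Integrable (⇑h) volume →
    (⇑(F h) : ℝ → ℂ) =ᵐ[volume]
      fun t : ℝ => ((Real.sqrt (2 * Real.pi) : ℂ))⁻¹ *
        ∫ ξ : ℝ, Complex.exp (-((t * ξ : ℝ) : ℂ) * Complex.I) * h ξ

open scoped InnerProductSpace
open Set Topology

lemma integrableOn_pow_mul_cexp_neg_mul {c : ℂ} (hc : 0 < c.re) (k : ℕ) :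
    IntegrableOn (fun ξ : ℝ => (ξ : ℂ) ^ k * Complex.exp (-c * ξ)) (Ioi 0) := by
  have h := integrableOn_rpow_mul_exp_neg_mul_rpow (p := 1) (s := k) (b := c.re)
    (by linarith [k.cast_nonneg (α := ℝ)]) one_pos hc
  refine h.congr' (by fun_prop) ?_
  filter_upwards [ae_restrict_mem measurableSet_Ioi] with x hx
  have hx : 0 < x := hx
  rw [norm_mul, norm_mul, norm_pow, Complex.norm_real, Complex.norm_exp, Real.norm_eq_abs,
    Real.norm_eq_abs, Real.norm_eq_abs, Real.abs_exp, abs_of_pos (Real.rpow_pos_of_pos hx _),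
    abs_of_pos hx]
  simp

lemma integral_pow_mul_cexp_neg_mul {c : ℂ} (hc : 0 < c.re) (k : ℕ) :
    ∫ ξ : ℝ in Ioi 0, (ξ : ℂ) ^ k * Complex.exp (-c * ξ) = k.factorial * (1 / c) ^ (k + 1) := by
  have hc0 : c ≠ 0 := by rintro rfl; simp at hc
  induction k with
  | zero =>
    simpa [neg_div_neg_eq] using integral_exp_mul_complex_Ioi (a := -c) (by simpa using hc) 0
  | succ k ih =>
    have hd : ∀ x ∈ Ioi (0 : ℝ), HasDerivAt
        (fun ξ : ℝ => (ξ : ℂ) ^ (k + 1) * Complex.exp (-c * ξ))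
        ((k + 1 : ℂ) * ((x : ℂ) ^ k * Complex.exp (-c * x))
          - c * ((x : ℂ) ^ (k + 1) * Complex.exp (-c * x))) x := by
      intro x _
      have h1 : HasDerivAt (fun z : ℂ => z ^ (k + 1) * Complex.exp (-c * z))
          ((k + 1 : ℂ) * ((x : ℂ) ^ k * Complex.exp (-c * x))
          - c * ((x : ℂ) ^ (k + 1) * Complex.exp (-c * x))) (x : ℂ) := by
        have h2 := (hasDerivAt_pow (k + 1) (x : ℂ)).mul
          (((hasDerivAt_id (x : ℂ)).const_mul (-c)).cexp)
        refine h2.congr_deriv ?_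
        rw [Nat.add_sub_cancel, id]
        push_cast
        ring
      exact h1.comp_ofReal
    have hlim : Tendsto (fun ξ : ℝ => (ξ : ℂ) ^ (k + 1) * Complex.exp (-c * ξ)) atTop (𝓝 0) := by
      rw [tendsto_zero_iff_norm_tendsto_zero]
      have h := (tendsto_rpow_mul_exp_neg_mul_atTop_nhds_zero (k + 1 : ℕ) c.re hc)
      refine h.congr' ?_
      filter_upwards [eventually_gt_atTop 0] with x hx
      rw [norm_mul, norm_pow, Complex.norm_real, Complex.norm_exp, Real.norm_eq_abs, abs_of_pos hx,
        Real.rpow_natCast]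
      simp
    have hI1 := integrableOn_pow_mul_cexp_neg_mul hc k
    have hI2 := integrableOn_pow_mul_cexp_neg_mul hc (k + 1)
    have h := integral_Ioi_of_hasDerivAt_of_tendsto
      (Continuous.continuousWithinAt (by fun_prop)) hd
      ((hI1.const_mul _).sub (hI2.const_mul _)) hlim
    rw [integral_sub (hI1.const_mul _) (hI2.const_mul _), integral_const_mul, integral_const_mul,
      ih] at h
    simp only [Complex.ofReal_zero, ne_eq, Nat.add_eq_zero_iff, one_ne_zero, and_false,
      not_false_eq_true, zero_pow, zero_mul, sub_zero, sub_eq_zero] at h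
    apply mul_left_cancel₀ hc0
    rw [← h, Nat.factorial_succ]
    push_cast
    linear_combination (-((k : ℂ) + 1) * k.factorial * (1 / c) ^ (k + 1)) * mul_one_div_cancel hc0

/-- The function `ξ ↦ ξᵏ e^{-ξ}` on `(0, ∞)`, extended by zero. -/
def powExpHalfLine (k : ℕ) : ℝ → ℂ :=
  (Ioi 0).indicator fun ξ : ℝ => (ξ : ℂ) ^ k * Complex.exp (-1 * ξ)

lemma integrable_powExpHalfLine (k : ℕ) : Integrable (powExpHalfLine k) :=
  (integrableOn_pow_mul_cexp_neg_mul (by simp) k).integrable_indicator measurableSet_Ioi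

lemma memLp_powExpHalfLine (k : ℕ) : MemLp (powExpHalfLine k) 2 := by
  rw [memLp_two_iff_integrable_sq_norm (integrable_powExpHalfLine k).1]
  have h := (integrable_indicator_iff measurableSet_Ioi).2
    (integrableOn_pow_mul_cexp_neg_mul (c := 2) (by simp) (2 * k)).norm
  refine h.congr (ae_of_all _ fun x => ?_)
  by_cases hx : x ∈ Ioi (0 : ℝ)
  · simp only [powExpHalfLine, indicator_of_mem hx]
    rw [← norm_pow, mul_pow, ← pow_mul, mul_comm k, ← Complex.exp_nat_mul]
    congr 3
    push_cast
    ring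
  · simp [powExpHalfLine, indicator_of_notMem hx]

lemma integral_cexp_mul_powExpHalfLine (t : ℝ) (k : ℕ) :
    ∫ ξ : ℝ, Complex.exp (-((t * ξ : ℝ) : ℂ) * Complex.I) * powExpHalfLine k ξ =
      k.factorial * (1 / (1 + t * Complex.I)) ^ (k + 1) := by
  rw [← integral_pow_mul_cexp_neg_mul (c := 1 + t * Complex.I) (by simp),
    ← integral_indicator measurableSet_Ioi]
  congr 1 with ξ
  by_cases hx : ξ ∈ Ioi (0 : ℝ)
  · simp only [powExpHalfLine, indicator_of_mem hx]
    rw [mul_left_comm, ← Complex.exp_add]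
    congr 2
    push_cast
    ring
  · simp [powExpHalfLine, indicator_of_notMem hx]

lemma integral_cexp_mul_powExpHalfLine_neg (t : ℝ) (k : ℕ) :
    ∫ ξ : ℝ, Complex.exp (-((t * ξ : ℝ) : ℂ) * Complex.I) * powExpHalfLine k (-ξ) =
      k.factorial * (1 / (1 - t * Complex.I)) ^ (k + 1) := by
  rw [← integral_neg_eq_self]
  have h := integral_cexp_mul_powExpHalfLine (-t) k
  simpa [sub_eq_add_neg] using h

/-- The closed subspace of `L²(ℝ)` of functions vanishing almost everywhere on `s`. -/
def vanishingOn (s : Set ℝ) : Submodule ℂ (Lp ℂ 2 (volume : Measure ℝ)) :=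
  (LpToLpRestrictCLM ℝ ℂ ℂ volume 2 s).ker

lemma mem_vanishingOn {s : Set ℝ} {h : Lp ℂ 2 (volume : Measure ℝ)} :
    h ∈ vanishingOn s ↔ ∀ᵐ t ∂(volume : Measure ℝ).restrict s, h t = 0 := by
  rw [vanishingOn, LinearMap.mem_ker, ContinuousLinearMap.coe_coe, Lp.eq_zero_iff_ae_eq_zero]
  have h1 := LpToLpRestrictCLM_coeFn ℂ s h
  exact ⟨fun h2 => h1.symm.trans h2, fun h2 => h1.trans h2⟩

lemma isClosed_vanishingOn (s : Set ℝ) : IsClosed (vanishingOn s : Set (Lp ℂ 2 (volume : Measure ℝ))) :=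
  (LpToLpRestrictCLM ℝ ℂ ℂ volume 2 s).isClosed_ker

lemma inner_eq_zero_of_mem_vanishingOn {s : Set ℝ} (hs : MeasurableSet s)
    {f g : Lp ℂ 2 (volume : Measure ℝ)} (hf : f ∈ vanishingOn s) (hg : g ∈ vanishingOn sᶜ) :
    ⟪f, g⟫_ℂ = 0 := by
  rw [mem_vanishingOn, ae_restrict_iff' hs] at hf
  rw [mem_vanishingOn, ae_restrict_iff' hs.compl] at hg
  rw [L2.inner_def]
  refine integral_eq_zero_of_ae ?_
  filter_upwards [hf, hg] with x hx hx'
  by_cases h : x ∈ s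
  · simp [hx h]
  · simp [hx' h]

/-- If a space of `L²` functions contains all powers `s, s², …`, then it contains
`s ^ (j + 1) * (2 s - 1) ^ n`. -/
lemma exists_mem_ae_eq_pow_mul {M : Submodule ℂ (Lp ℂ 2 (volume : Measure ℝ))} {s : ℝ → ℂ}
    (h : ∀ k : ℕ, ∃ f ∈ M, f =ᵐ[volume] fun t => s t ^ (k + 1)) (n j : ℕ) :
    ∃ f ∈ M, f =ᵐ[volume] fun t => s t ^ (j + 1) * (2 * s t - 1) ^ n := by
  induction n generalizing j with
  | zero => simpa using h j
  | succ n ih =>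
    obtain ⟨f, hf, hf'⟩ := ih j
    obtain ⟨g, hg, hg'⟩ := ih (j + 1)
    refine ⟨(2 : ℂ) • g - f, M.sub_mem (M.smul_mem _ hg) hf, ?_⟩
    filter_upwards [Lp.coeFn_sub ((2 : ℂ) • g) f, Lp.coeFn_smul (2 : ℂ) g, hf', hg'] with
      t h1 h2 h3 h4
    rw [h1, Pi.sub_apply, h2, Pi.smul_apply, h3, h4, smul_eq_mul]
    ring

section Fourier

variable {F : Lp ℂ 2 (volume : Measure ℝ) ≃ₗᵢ[ℂ] Lp ℂ 2 (volume : Measure ℝ)}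

/-- If the Fourier integral of `p` is a nonzero multiple of `q`, then `q` is the Fourier
transform of a multiple of `p`. -/
lemma exists_mem_map_vanishingOn (hF : FourierConvention F) {s : Set ℝ} (hs : MeasurableSet s)
    {p q : ℝ → ℂ} {c : ℂ} (hc : c ≠ 0) (hp : Integrable p) (hp2 : MemLp p 2)
    (hps : ∀ x ∈ s, p x = 0)
    (hpq : ∀ t : ℝ, ∫ ξ : ℝ, Complex.exp (-((t * ξ : ℝ) : ℂ) * Complex.I) * p ξ = c * q t) :
    ∃ f ∈ (vanishingOn s).map F.toLinearEquiv.toLinearMap, f =ᵐ[volume] q := by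
  have hmem : hp2.toLp p ∈ vanishingOn s := by
    rw [mem_vanishingOn, ae_restrict_iff' hs]
    filter_upwards [hp2.coeFn_toLp] with x hx hxs
    rw [hx, hps x hxs]
  have hd : ((Real.sqrt (2 * Real.pi) : ℂ))⁻¹ * c ≠ 0 := by
    refine mul_ne_zero (inv_ne_zero ?_) hc
    exact_mod_cast (Real.sqrt_pos.2 Real.two_pi_pos).ne'
  refine ⟨F ((((Real.sqrt (2 * Real.pi) : ℂ))⁻¹ * c)⁻¹ • hp2.toLp p),
    Submodule.mem_map_of_mem (Submodule.smul_mem _ _ hmem), ?_⟩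
  rw [map_smul]
  filter_upwards [Lp.coeFn_smul (((Real.sqrt (2 * Real.pi) : ℂ))⁻¹ * c)⁻¹ (F (hp2.toLp p)),
    hF _ (hp.congr hp2.coeFn_toLp.symm)] with t h1 h2
  have h3 : ∫ ξ : ℝ, Complex.exp (-((t * ξ : ℝ) : ℂ) * Complex.I) * hp2.toLp p ξ = c * q t := by
    rw [← hpq t]
    refine integral_congr_ae ?_
    filter_upwards [hp2.coeFn_toLp] with ξ hξ
    rw [hξ]
  rw [h1, Pi.smul_apply, h2, h3, smul_eq_mul, ← mul_assoc _ c, inv_mul_cancel_left₀ hd]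

lemma exists_mem_map_vanishingOn_Iio (hF : FourierConvention F) (k : ℕ) :
    ∃ f ∈ (vanishingOn (Iio 0)).map F.toLinearEquiv.toLinearMap,
      f =ᵐ[volume] fun t : ℝ => (1 / (1 + t * Complex.I)) ^ (k + 1) :=
  exists_mem_map_vanishingOn hF measurableSet_Iio (Nat.cast_ne_zero.2 k.factorial_ne_zero)
    (integrable_powExpHalfLine k) (memLp_powExpHalfLine k)
    (fun _ hx => indicator_of_notMem (not_lt.2 (mem_Iio.1 hx).le) _)
    (fun t => integral_cexp_mul_powExpHalfLine t k)

lemma exists_mem_map_vanishingOn_Ici (hF : FourierConvention F) (k : ℕ) :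
    ∃ f ∈ (vanishingOn (Iio 0)ᶜ).map F.toLinearEquiv.toLinearMap,
      f =ᵐ[volume] fun t : ℝ => (1 / (1 - t * Complex.I)) ^ (k + 1) :=
  exists_mem_map_vanishingOn hF measurableSet_Iio.compl
    (Nat.cast_ne_zero.2 k.factorial_ne_zero)
    (integrable_powExpHalfLine k).comp_neg
    ((memLp_powExpHalfLine k).comp_measurePreserving (Measure.measurePreserving_neg volume))
    (fun x hx => indicator_of_notMem (by simpa using hx) _)
    (fun t => integral_cexp_mul_powExpHalfLine_neg t k)

end Fourier

section Circle

instance : Fact (0 < 2 * Real.pi) := ⟨Real.two_pi_pos⟩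

lemma measurePreserving_toCircle :
    MeasurePreserving (fun x : AddCircle (2 * Real.pi) => (AddCircle.toCircle x : ℂ))
      volume circleMeasure := by
  have hm : Measurable (fun x : AddCircle (2 * Real.pi) => (AddCircle.toCircle x : ℂ)) :=
    (continuous_subtype_val.comp AddCircle.continuous_toCircle).measurable
  refine ⟨hm, ?_⟩
  have h := AddCircle.measurePreserving_mk (2 * Real.pi) (-Real.pi)
  rw [← h.map_eq, Measure.map_map hm h.measurable, circleMeasure,
    show -Real.pi + 2 * Real.pi = Real.pi by ring]
  congr 1 with θ
  simp [AddCircle.toCircle_apply_mk, Circle.coe_exp, Real.pi_ne_zero]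

lemma ae_circleMeasure_norm_eq_one : ∀ᵐ z ∂circleMeasure, ‖z‖ = 1 := by
  rw [circleMeasure, ae_map_iff (by fun_prop) (measurableSet_eq_fun (by fun_prop) (by fun_prop))]
  exact ae_of_all _ fun θ => Complex.norm_exp_ofReal_mul_I θ

instance : IsFiniteMeasure circleMeasure := by
  unfold circleMeasure; infer_instance

lemma memLp_circleMeasure_zpow (n : ℤ) : MemLp (fun z : ℂ => z ^ n) 2 circleMeasure := by
  refine MemLp.of_bound (by fun_prop) 1 ?_
  filter_upwards [ae_circleMeasure_norm_eq_one] with z hz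
  simp [hz]

/-- The monomial `z ↦ zⁿ` in `L²(S¹)`. -/
def circleMonomial (n : ℤ) : Lp ℂ 2 circleMeasure := (memLp_circleMeasure_zpow n).toLp _

lemma coeFn_circleMonomial (n : ℤ) : circleMonomial n =ᵐ[circleMeasure] fun z => z ^ n :=
  (memLp_circleMeasure_zpow n).coeFn_toLp

/-- The monomials are total in `L²(S¹)`. -/
lemma eq_zero_of_inner_circleMonomial_eq_zero {g : Lp ℂ 2 circleMeasure}
    (hg : ∀ n : ℤ, ⟪circleMonomial n, g⟫_ℂ = 0) : g = 0 := by
  have hmp := measurePreserving_toCircle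
  have hf : MemLp (fun x : AddCircle (2 * Real.pi) => g (AddCircle.toCircle x : ℂ)) 2
      AddCircle.haarAddCircle := ((Lp.memLp g).comp_measurePreserving hmp).haarAddCircle
  have hint (f : ℂ → ℂ) (hf : AEStronglyMeasurable f circleMeasure) :
      ∫ z, f z ∂circleMeasure = ∫ x : AddCircle (2 * Real.pi), f (AddCircle.toCircle x) := by
    rw [← hmp.map_eq] at hf ⊢
    exact integral_map hmp.aemeasurable hf
  have hz : hf.toLp _ = 0 := by
    apply fourierBasis.repr.injective
    ext n
    rw [fourierBasis_repr, map_zero, lp.coeFn_zero, Pi.zero_apply, fourierCoeff,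
      integral_congr_ae (hf.coeFn_toLp.mono fun x hx => congrArg (fourier (-n) x • ·) hx),
      AddCircle.integral_haarAddCircle]
    have h := hg n
    rw [L2.inner_def, hint _ (L2.integrable_inner (𝕜 := ℂ) (circleMonomial n) g).1] at h
    refine smul_eq_zero_of_right _ (Eq.trans (integral_congr_ae ?_) h)
    filter_upwards [hmp.quasiMeasurePreserving.ae (coeFn_circleMonomial n)] with x hx
    rw [hx, RCLike.inner_apply', fourier_neg, fourier_apply, AddCircle.toCircle_zsmul,
      Circle.coe_zpow, smul_eq_mul]
  have hae (f : ℂ → ℂ) (hf : Measurable f)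
      (h : ∀ᵐ x : AddCircle (2 * Real.pi), f (AddCircle.toCircle x) = 0) :
      f =ᵐ[circleMeasure] 0 := by
    rw [← hmp.map_eq]
    exact (ae_map_iff hmp.aemeasurable (measurableSet_eq_fun hf measurable_zero)).2 h
  refine Lp.eq_zero_iff_ae_eq_zero.2 (hae _ (Lp.stronglyMeasurable g).measurable ?_)
  rw [AddCircle.volume_eq_smul_haarAddCircle]
  exact Measure.ae_smul_measure (hf.coeFn_toLp.symm.trans (Lp.eq_zero_iff_ae_eq_zero.1 hz)) _

end Circle

/-- The Cayley transform is nonsingular from Lebesgue measure to arc length. -/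
lemma quasiMeasurePreserving_cayley :
    Measure.QuasiMeasurePreserving
      (fun t : ℝ => (1 - (t : ℂ) * Complex.I) / (1 + (t : ℂ) * Complex.I)) volume circleMeasure := by
  refine ⟨by fun_prop, ?_⟩
  refine Measure.AbsolutelyContinuous.mk fun N hN hN0 => ?_
  rw [circleMeasure, Measure.map_apply (by fun_prop) hN,
    Measure.restrict_apply ((by fun_prop : Measurable fun θ : ℝ =>
      Complex.exp (θ * Complex.I)) hN)] at hN0
  rw [Measure.map_apply (by fun_prop) hN]
  set A := (fun θ : ℝ => Complex.exp (θ * Complex.I)) ⁻¹' N ∩ Ioo (-Real.pi) Real.pi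
  have hA0 : volume A = 0 :=
    measure_mono_null (inter_subset_inter_right _ Ioo_subset_Ioc_self) hN0
  have hd : DifferentiableOn ℝ (fun θ : ℝ => Real.tan (-θ / 2)) A := by
    intro θ hθ
    have : -θ / 2 ∈ Ioo (-(Real.pi / 2)) (Real.pi / 2) :=
      ⟨by linarith [hθ.2.2], by linarith [hθ.2.1]⟩
    exact ((Real.differentiableAt_tan_of_mem_Ioo this).comp θ
      (by fun_prop : DifferentiableAt ℝ (fun θ : ℝ => -θ / 2) θ)).differentiableWithinAt
  refine measure_mono_null (fun t ht => ?_)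
    (addHaar_image_eq_zero_of_differentiableOn_of_addHaar_eq_zero volume hd hA0)
  refine ⟨-2 * Real.arctan t, ⟨?_, ?_, ?_⟩, ?_⟩
  · have : Complex.exp ((-2 * Real.arctan t : ℝ) * Complex.I) =
        (1 - (t : ℂ) * Complex.I) / (1 + (t : ℂ) * Complex.I) := by
      have hc : (Real.cos (Real.arctan t) : ℂ) ≠ 0 := by
        exact_mod_cast (Real.cos_arctan_pos t).ne'
      have hs : (Real.sin (Real.arctan t) : ℂ) = t * Real.cos (Real.arctan t) := by
        rw [← Complex.ofReal_mul, ← Real.tan_mul_cos (Real.cos_arctan_pos t).ne', Real.tan_arctan]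
      have he : ((-2 * Real.arctan t : ℝ) : ℂ) * Complex.I =
          ((-Real.arctan t : ℝ) : ℂ) * Complex.I - (Real.arctan t : ℂ) * Complex.I := by
        push_cast
        ring
      rw [he, Complex.exp_sub, Complex.exp_ofReal_mul_I, Complex.exp_ofReal_mul_I, Real.cos_neg,
        Real.sin_neg, Complex.ofReal_neg, hs]
      conv_rhs => rw [← mul_div_mul_left _ _ hc]
      congr 1 <;> ring
    rw [mem_preimage, this]
    exact ht
  · linarith [Real.arctan_lt_pi_div_two t]
  · linarith [Real.neg_pi_div_two_lt_arctan t]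
  · simp [Real.tan_arctan]

lemma one_add_ofReal_mul_I_ne_zero (t : ℝ) : 1 + (t : ℂ) * Complex.I ≠ 0 := by
  intro h
  simpa using congrArg Complex.re h

lemma one_sub_ofReal_mul_I_ne_zero (t : ℝ) : 1 - (t : ℂ) * Complex.I ≠ 0 := by
  intro h
  simpa using congrArg Complex.re h

lemma IsCayleyUnitary.coeFn_circleMonomial
    {U : Lp ℂ 2 circleMeasure ≃ₗᵢ[ℂ] Lp ℂ 2 (volume : Measure ℝ)} (hU : IsCayleyUnitary U)
    (n : ℤ) :
    U (circleMonomial n) =ᵐ[volume] fun t : ℝ =>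
      ((Real.sqrt 2 : ℂ) / (1 + (t : ℂ) * Complex.I)) *
        ((1 - (t : ℂ) * Complex.I) / (1 + (t : ℂ) * Complex.I)) ^ n := by
  filter_upwards [hU (circleMonomial n),
    quasiMeasurePreserving_cayley.ae (_root_.coeFn_circleMonomial n)] with t h1 h2
  rw [h1, h2]

lemma IsCayleyUnitary.map_circleMonomial_mem
    {U : Lp ℂ 2 circleMeasure ≃ₗᵢ[ℂ] Lp ℂ 2 (volume : Measure ℝ)} (hU : IsCayleyUnitary U)
    {M : Submodule ℂ (Lp ℂ 2 (volume : Measure ℝ))}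
    (h : ∀ k : ℕ, ∃ f ∈ M, f =ᵐ[volume] fun t : ℝ => (1 / (1 + t * Complex.I)) ^ (k + 1))
    (n : ℕ) : U (circleMonomial n) ∈ M := by
  obtain ⟨f, hf, hf'⟩ := exists_mem_ae_eq_pow_mul h n 0
  have : U (circleMonomial n) = (Real.sqrt 2 : ℂ) • f := by
    apply Lp.ext
    filter_upwards [hU.coeFn_circleMonomial n, Lp.coeFn_smul (Real.sqrt 2 : ℂ) f, hf'] with
      t h1 h2 h3
    have h0 := one_add_ofReal_mul_I_ne_zero t
    rw [h1, h2, Pi.smul_apply, h3, smul_eq_mul, zpow_natCast,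
      show 2 * (1 / (1 + t * Complex.I)) - 1 = (1 - (t : ℂ) * Complex.I) / (1 + t * Complex.I) by
        field_simp; ring]
    ring
  rw [this]
  exact M.smul_mem _ hf

lemma IsCayleyUnitary.map_circleMonomial_negSucc_mem
    {U : Lp ℂ 2 circleMeasure ≃ₗᵢ[ℂ] Lp ℂ 2 (volume : Measure ℝ)} (hU : IsCayleyUnitary U)
    {M : Submodule ℂ (Lp ℂ 2 (volume : Measure ℝ))}
    (h : ∀ k : ℕ, ∃ f ∈ M, f =ᵐ[volume] fun t : ℝ => (1 / (1 - t * Complex.I)) ^ (k + 1))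
    (n : ℕ) : U (circleMonomial (Int.negSucc n)) ∈ M := by
  obtain ⟨f, hf, hf'⟩ := exists_mem_ae_eq_pow_mul h n 0
  have : U (circleMonomial (Int.negSucc n)) = (Real.sqrt 2 : ℂ) • f := by
    apply Lp.ext
    filter_upwards [hU.coeFn_circleMonomial (Int.negSucc n), Lp.coeFn_smul (Real.sqrt 2 : ℂ) f,
      hf'] with t h1 h2 h3
    have h0 := one_add_ofReal_mul_I_ne_zero t
    have h0' := one_sub_ofReal_mul_I_ne_zero t
    rw [h1, h2, Pi.smul_apply, h3, smul_eq_mul, zpow_negSucc, ← inv_pow, inv_div,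
      show 2 * (1 / (1 - t * Complex.I)) - 1 = (1 + (t : ℂ) * Complex.I) / (1 - t * Complex.I) by
        field_simp; ring, pow_succ, zero_add, pow_one]
    field_simp
  rw [this]
  exact M.smul_mem _ hf

lemma hardySpace_eq_topologicalClosure_span :
    hardySpace = (Submodule.span ℂ
      (range fun n : ℕ => circleMonomial n)).topologicalClosure := by
  rw [hardySpace]
  congr 2
  ext f
  constructor
  · rintro ⟨n, hn⟩
    refine ⟨n, Lp.ext ?_⟩
    filter_upwards [hn, coeFn_circleMonomial n] with z h1 h2
    rw [h1, h2, zpow_natCast]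
  · rintro ⟨n, rfl⟩
    refine ⟨n, ?_⟩
    filter_upwards [coeFn_circleMonomial n] with z h
    rw [h, zpow_natCast]

/-- `U(H²) = F(L²₊)`, where `L²₊` is the space of `L²`-functions
vanishing a.e. on `(-∞, 0)`. -/
theorem cayley_image_hardy_eq_fourier_image_halfline
    (U : Lp ℂ 2 circleMeasure ≃ₗᵢ[ℂ] Lp ℂ 2 (volume : Measure ℝ))
    (hU : IsCayleyUnitary U)
    (F : Lp ℂ 2 (volume : Measure ℝ) ≃ₗᵢ[ℂ] Lp ℂ 2 (volume : Measure ℝ))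
    (hF : FourierConvention F) :
    (⇑U '' (hardySpace : Set (Lp ℂ 2 circleMeasure)))
      = ⇑F '' {h : Lp ℂ 2 (volume : Measure ℝ) |
          ∀ᵐ t ∂((volume : Measure ℝ).restrict (Set.Iio (0:ℝ))), h t = 0} := by
  have hset : {h : Lp ℂ 2 (volume : Measure ℝ) |
      ∀ᵐ t ∂((volume : Measure ℝ).restrict (Set.Iio (0:ℝ))), h t = 0} = vanishingOn (Iio 0) := by
    ext h
    exact mem_vanishingOn.symm
  rw [hset]
  have hpos := hU.map_circleMonomial_mem (exists_mem_map_vanishingOn_Iio hF)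
  have hneg := hU.map_circleMonomial_negSucc_mem (exists_mem_map_vanishingOn_Ici hF)
  have hsub : ∀ p ∈ hardySpace, F.symm (U p) ∈ vanishingOn (Iio 0) := by
    intro p hp
    have hle : hardySpace ≤ (vanishingOn (Iio 0)).comap
        (U.trans F.symm).toLinearEquiv.toLinearMap := by
      rw [hardySpace_eq_topologicalClosure_span]
      refine Submodule.topologicalClosure_minimal _ (Submodule.span_le.2 ?_)
        ((isClosed_vanishingOn _).preimage (U.trans F.symm).continuous)
      rintro _ ⟨n, rfl⟩
      obtain ⟨h, hh, hh'⟩ := hpos n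
      change F.symm (U (circleMonomial n)) ∈ vanishingOn (Iio 0)
      rw [← hh']
      simpa using hh
    exact hle hp
  apply Subset.antisymm
  · rintro _ ⟨p, hp, rfl⟩
    exact ⟨F.symm (U p), hsub p hp, F.apply_symm_apply _⟩
  · rintro _ ⟨h, hh, rfl⟩
    have : CompleteSpace hardySpace :=
      (Submodule.isClosed_topologicalClosure _).completeSpace_coe
    obtain ⟨p, hp, q, hq, hpq⟩ := hardySpace.exists_add_mem_mem_orthogonal (U.symm (F h))
    have hUq : F.symm (U q) ∈ vanishingOn (Iio 0) := by
      have : F.symm (U q) = h - F.symm (U p) := by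
        rw [eq_sub_iff_add_eq, ← map_add, ← map_add, add_comm q p, ← hpq]
        simp
      rw [this]
      exact Submodule.sub_mem _ hh (hsub p hp)
    have hq0 : q = 0 := by
      refine eq_zero_of_inner_circleMonomial_eq_zero fun n => ?_
      cases n with
      | ofNat n =>
        refine (Submodule.mem_orthogonal _ _).1 hq _ ?_
        rw [hardySpace_eq_topologicalClosure_span]
        exact Submodule.le_topologicalClosure _ (Submodule.subset_span ⟨n, rfl⟩)
      | negSucc n =>
        obtain ⟨k, hk, hk'⟩ := hneg n
        rw [← U.inner_map_map, ← hk', ← F.symm.inner_map_map, inner_eq_zero_symm]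
        refine inner_eq_zero_of_mem_vanishingOn measurableSet_Iio hUq ?_
        simpa using hk
    refine ⟨p, hp, ?_⟩
    rw [← U.apply_symm_apply (F h), hpq, hq0, add_zero]

end
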